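/- arXiv:2506.14031 — 2 statements merged into one kernel-verified Lean document; each statement's English description precedes it below -/
import Mathlib

section
/- Suppose [·,·] is a Lie bracket on ℝ^7 and Λ : ℝ^7 → 𝔤𝔩(7,ℝ) is a linear map with Λ(x)y − Λ(y)x = [x,y] and Λ(x) ∈ 𝔥^III for all x,y ∈ ℝ^7. Write Λ(e_i) = h(A_i, v_i, (y_{i1},y_{i2})). If tr(A_1) = 0 or tr(A_4) = 0, then v_1 = 0. -/
open Matrix

noncomputable section

abbrev V7 : Type := Fin 7 → ℝ
abbrev M7 : Type := Matrix (Fin 7) (Fin 7) ℝ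
abbrev M2 : Type := Matrix (Fin 2) (Fin 2) ℝ

/-- The standard basis of `ℝ^7` (0-indexed: `e 0` is `e_1` of the paper). -/
def e (i : Fin 7) : V7 := Pi.single i 1

/-- The matrix `h(A,v,u,y)`. -/
def hmat (A : M2) (v : ℝ) (u y : Fin 2 → ℝ) : M7 :=
  !![A 0 0 + A 1 1, -u 1, u 0, Real.sqrt 2 * v, 0, -y 0, -y 1;
     0, A 0 0, A 0 1, Real.sqrt 2 * u 0, y 0, 0, v;
     0, A 1 0, A 1 1, Real.sqrt 2 * u 1, y 1, -v, 0;
     0, 0, 0, 0, Real.sqrt 2 * v, Real.sqrt 2 * u 0, Real.sqrt 2 * u 1;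
     0, 0, 0, 0, -(A 0 0 + A 1 1), 0, 0;
     0, 0, 0, 0, u 1, -A 0 0, -A 1 0;
     0, 0, 0, 0, -u 0, -A 0 1, -A 1 1]

/-- `𝔥^I = {h(A,v,u,y)}`. -/
def hI : Set M7 := {X | ∃ A v u y, X = hmat A v u y}

/-- The matrix `h(A,v,y) := h(A,v,0,y)`. -/
def h3 (A : M2) (v : ℝ) (y : Fin 2 → ℝ) : M7 := hmat A v 0 y

/-- `𝔥^III = {h(A,v,y)}`. -/
def hIII : Set M7 := {X | ∃ A v y, X = h3 A v y}

/-- `𝔪(1,0,1) = {h(0,v,(y_1,0))}`. -/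
def m101 : Set M7 := {X | ∃ v y1, X = h3 0 v ![y1, 0]}

/-- `𝔪(1,0,2) = {h(0,v,(y_1,y_2))}`. -/
def m102 : Set M7 := {X | ∃ v y, X = h3 0 v y}

/-- The projection `pro_A` (reading off the relevant entries; on `𝔥^III` and `𝔥^I`
it gives the `𝔤𝔩(2,ℝ)`-component `A`). -/
def proA (X : M7) : M2 := !![X 1 1, X 1 2; X 2 1, X 2 2]

/-- The projection `pro_v` (on `𝔥^III` and `𝔥^I` it gives the component `v`). -/
def proV (X : M7) : ℝ := X 1 6

/-- In the `e_5`-direction, the action of `h3 A v y` is multiplication by `-tr A`. -/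
lemma h3_mulVec_four (A : M2) (v : ℝ) (y : Fin 2 → ℝ) (x : V7) :
    ((h3 A v y).mulVec x) 4 = -(A 0 0 + A 1 1) * x 4 := by
  simp [h3, hmat, mulVec, dotProduct, Fin.sum_univ_succ, Fin.succ]

/-- The `e_4`-component of the action of `h3 A v y`. -/
lemma h3_mulVec_three (A : M2) (v : ℝ) (y : Fin 2 → ℝ) (x : V7) :
    ((h3 A v y).mulVec x) 3 = √2 * v * x 4 := by
  simp [h3, hmat, mulVec, dotProduct, Fin.sum_univ_succ, Fin.succ]

lemma h3_mulVec_e_zero (A : M2) (v : ℝ) (y : Fin 2 → ℝ) :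
    (h3 A v y).mulVec (e 0) = (A 0 0 + A 1 1) • e 0 := by
  ext i; fin_cases i <;> simp [h3, hmat, e]

lemma h3_mulVec_e_three (A : M2) (v : ℝ) (y : Fin 2 → ℝ) :
    (h3 A v y).mulVec (e 3) = (√2 * v) • e 0 := by
  ext i; fin_cases i <;> simp [h3, hmat, e]

lemma trace_proA_h3 (A : M2) (v : ℝ) (y : Fin 2 → ℝ) :
    (proA (h3 A v y)).trace = A 0 0 + A 1 1 := by
  simp [proA, h3, hmat, trace_fin_two]

lemma proV_h3 (A : M2) (v : ℝ) (y : Fin 2 → ℝ) : proV (h3 A v y) = v := by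
  simp [proV, h3, hmat]

theorem stmt6 (bk : V7 → V7 → V7) (L : V7 →ₗ[ℝ] M7)
    (hbk : ∀ x y : V7, (L x).mulVec y - (L y).mulVec x = bk x y)
    (halt : ∀ x : V7, bk x x = 0)
    (hjac : ∀ x y z : V7, bk (bk x y) z + bk (bk y z) x + bk (bk z x) y = 0)
    (hL : ∀ x, L x ∈ hIII)
    (h : (proA (L (e 0))).trace = 0 ∨ (proA (L (e 3))).trace = 0) :
    proV (L (e 0)) = 0 := by
  obtain ⟨A₁, v₁, y₁, h₁⟩ := hL (e 0)
  obtain ⟨A₄, v₄, y₄, h₄⟩ := hL (e 3)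
  obtain ⟨A₅, v₅, y₅, h₅⟩ := hL (e 4)
  obtain ⟨B, p, q, hB⟩ := hL (bk (e 3) (e 4))
  obtain ⟨C, r, s, hC⟩ := hL (bk (e 4) (e 0))
  rw [h₁, h₄, trace_proA_h3, trace_proA_h3] at h
  rw [h₁, proV_h3]
  have hbk₁₄ : bk (e 0) (e 3) = (√2 * v₁ - (A₄ 0 0 + A₄ 1 1)) • e 0 := by
    rw [← hbk, h₁, h₄, h3_mulVec_e_three, h3_mulVec_e_zero, sub_smul]
  have hjac₁₄₅ := hjac (e 0) (e 3) (e 4)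
  rw [hbk₁₄, ← hbk (_ • _), ← hbk (bk _ _), ← hbk (bk _ _), hB, hC, map_smul, h₁, h₄, h₅,
    ← hbk (e 3), ← hbk (e 4), h₁, h₄, h₅] at hjac₁₄₅
  have hmul : (√2 * v₁ - (A₄ 0 0 + A₄ 1 1)) * (A₁ 0 0 + A₁ 1 1) = 0 := by
    have h_four := congrFun hjac₁₄₅ 4
    simp only [Pi.add_apply, Pi.sub_apply, Pi.smul_apply, Pi.zero_apply, smul_mulVec,
      mulVec_smul, smul_eq_mul, h3_mulVec_four] at h_four
    simp [e] at h_four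
    linarith
  have hsq : √2 * (√2 * v₁ ^ 2 - v₄ * (A₁ 0 0 + A₁ 1 1)) = 0 := by
    have h_three := congrFun hjac₁₄₅ 3
    simp only [Pi.add_apply, Pi.sub_apply, Pi.smul_apply, Pi.zero_apply, smul_mulVec,
      mulVec_smul, smul_eq_mul, h3_mulVec_four, h3_mulVec_three] at h_three
    simp [e] at h_three
    linarith
  have hsqrt : √2 ≠ 0 := by positivity
  by_contra hv
  have htr : A₁ 0 0 + A₁ 1 1 = 0 := by
    rcases h with h | h
    · exact h
    · simpa [h, hsqrt, hv] using hmul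
  simp [htr, hsqrt, hv] at hsq
end
end

section
/- Suppose [·,·] is a Lie bracket on ℝ^7 and Λ : ℝ^7 → 𝔤𝔩(7,ℝ) is a linear map with Λ(x)y − Λ(y)x = [x,y] and Λ(x) ∈ 𝔥^III for all x,y ∈ ℝ^7. Then: (i) if R(e_1,e_5) = 0 and R(e_4,e_5) = 0, the infinitesimal holonomy 𝔥 is decomposable; (ii) if Λ(e_1) = 0 and Λ(e_4) = h(0, v, (0,0)) for some v ∈ ℝ, then 𝔥 is decomposable. -/
open Matrix

noncomputable section

/-- The symmetric bilinear form of signature (4,3):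
`⟨e_1,e_5⟩ = ⟨e_2,e_6⟩ = ⟨e_3,e_7⟩ = 1`, `⟨e_4,e_4⟩ = −1`. -/
def ip (u v : V7) : ℝ :=
  u 0 * v 4 + u 4 * v 0 + u 1 * v 5 + u 5 * v 1 + u 2 * v 6 + u 6 * v 2 - u 3 * v 3

/-- The curvature `R(x,y) = Λ(x)Λ(y) − Λ(y)Λ(x) − Λ([x,y])`. -/
def curv (L : V7 →ₗ[ℝ] M7) (bk : V7 → V7 → V7) (x y : V7) : M7 :=
  L x * L y - L y * L x - L (bk x y)

/-- The infinitesimal holonomy: the smallest linear subspace of `𝔤𝔩(7,ℝ)` containing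
all `R(x,y)` and stable under bracketing with all `Λ(z)`. -/
def infHol (L : V7 →ₗ[ℝ] M7) (bk : V7 → V7 → V7) : Submodule ℝ M7 :=
  sInf {H : Submodule ℝ M7 | (∀ x y, curv L bk x y ∈ H) ∧
    ∀ z : V7, ∀ X ∈ H, L z * X - X * L z ∈ H}

/-- A set of matrices is decomposable if some nontrivial proper subspace `W` is invariant
and the restriction of `⟨·,·⟩` to `W` is nondegenerate. -/
def Decomposable (H : Set M7) : Prop :=
  ∃ W : Submodule ℝ V7, W ≠ ⊥ ∧ W ≠ ⊤ ∧
    (∀ X ∈ H, ∀ w ∈ W, X.mulVec w ∈ W) ∧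
    (∀ w ∈ W, (∀ w' ∈ W, ip w w' = 0) → w = 0)

theorem h3_mulVec (A : M2) (v : ℝ) (y : Fin 2 → ℝ) (x : V7) :
    h3 A v y *ᵥ x =
      ![A.trace * x 0 + Real.sqrt 2 * v * x 3 - y 0 * x 5 - y 1 * x 6,
        A 0 0 * x 1 + A 0 1 * x 2 + y 0 * x 4 + v * x 6,
        A 1 0 * x 1 + A 1 1 * x 2 + y 1 * x 4 - v * x 5,
        Real.sqrt 2 * v * x 4,
        -A.trace * x 4,
        -A 0 0 * x 5 - A 1 0 * x 6,
        -A 0 1 * x 5 - A 1 1 * x 6] := by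
  ext i
  fin_cases i <;>
    simp [h3, hmat, Matrix.mulVec, dotProduct, Fin.sum_univ_succ, Matrix.trace_fin_two] <;> ring

/-- The bracket of two elements of `𝔥^III` in the parameters `(A, v, y)`. -/
theorem h3_commutator (A B : M2) (v w : ℝ) (y z : Fin 2 → ℝ) :
    h3 A v y * h3 B w z - h3 B w z * h3 A v y =
      h3 (A * B - B * A) (A.trace * w - B.trace * v)
        (A *ᵥ z - B *ᵥ y + A.trace • z - B.trace • y) := by
  refine Matrix.ext_iff_mulVec.mpr fun x => ?_
  rw [Matrix.sub_mulVec, ← Matrix.mulVec_mulVec, ← Matrix.mulVec_mulVec]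
  simp only [h3_mulVec]
  ext i
  fin_cases i <;>
    simp [Matrix.mul_apply, Fin.sum_univ_two, Matrix.trace_fin_two,
      Matrix.vecHead, Matrix.vecTail] <;> ring

theorem h3_add (A B : M2) (v w : ℝ) (y z : Fin 2 → ℝ) :
    h3 A v y + h3 B w z = h3 (A + B) (v + w) (y + z) := by
  ext i j
  fin_cases i <;> fin_cases j <;> simp [h3, hmat] <;> ring

theorem h3_smul (c : ℝ) (A : M2) (v : ℝ) (y : Fin 2 → ℝ) :
    c • h3 A v y = h3 (c • A) (c * v) (c • y) := by
  ext i j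
  fin_cases i <;> fin_cases j <;> simp [h3, hmat] <;> ring

theorem h3_zero : h3 0 0 0 = 0 := by
  ext i j
  fin_cases i <;> fin_cases j <;> simp [h3, hmat]

theorem ip_h3_skew (A : M2) (v : ℝ) (y : Fin 2 → ℝ) (z w : V7) :
    ip (h3 A v y *ᵥ z) w = -ip (h3 A v y *ᵥ w) z := by
  simp [ip, h3, hmat, Matrix.mulVec, dotProduct, Fin.sum_univ_succ]
  ring

theorem ip_add_left (u v w : V7) : ip (u + v) w = ip u w + ip v w := by
  simp [ip]
  ring

theorem ip_zero_left (w : V7) : ip 0 w = 0 := by simp [ip]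

/-- The elements of `𝔥^III` with `tr A = 0` and `v = 0`. -/
def traceFreeStabilizer : Submodule ℝ M7 where
  carrier := {X | ∃ A y, A.trace = 0 ∧ X = h3 A 0 y}
  zero_mem' := ⟨0, 0, by simp, h3_zero.symm⟩
  add_mem' := by
    rintro _ _ ⟨A, y, hA, rfl⟩ ⟨B, z, hB, rfl⟩
    exact ⟨A + B, y + z, by simp [hA, hB], by simp [h3_add]⟩
  smul_mem' := by
    rintro c _ ⟨A, y, hA, rfl⟩
    exact ⟨c • A, c • y, by simp [hA], by simp [h3_smul]⟩

section

variable {L : V7 →ₗ[ℝ] M7} {bk : V7 → V7 → V7}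

theorem curv_mem_hIII (hL : ∀ x, L x ∈ hIII) (x y : V7) : curv L bk x y ∈ hIII := by
  obtain ⟨A, v, p, hx⟩ := hL x
  obtain ⟨B, w, q, hy⟩ := hL y
  obtain ⟨C, u, r, hxy⟩ := hL (bk x y)
  rw [curv, hx, hy, hxy, h3_commutator, sub_eq_add_neg, ← neg_one_smul ℝ, h3_smul, h3_add]
  exact ⟨_, _, _, rfl⟩

theorem infHol_le_traceFreeStabilizer (hL : ∀ x, L x ∈ hIII)
    (hR : ∀ x y, curv L bk x y ∈ traceFreeStabilizer) :
    infHol L bk ≤ traceFreeStabilizer := by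
  refine sInf_le ⟨hR, ?_⟩
  rintro z _ ⟨B, q, hB, rfl⟩
  obtain ⟨A, v, p, hz⟩ := hL z
  rw [hz, h3_commutator]
  rw [hB, mul_zero, zero_mul, sub_zero]
  exact ⟨_, _, by rw [Matrix.trace_sub, Matrix.trace_mul_comm, sub_self], rfl⟩

/-- A space of matrices annihilating the non-null vector `e 3` is decomposable. -/
theorem decomposable_of_mulVec_e3 {H : Set M7} (h : ∀ X ∈ H, X *ᵥ e 3 = 0) :
    Decomposable H := by
  refine ⟨Submodule.span ℝ {e 3}, ?_, ?_, ?_, ?_⟩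
  · intro h0
    have := congrFun (Submodule.span_singleton_eq_bot.mp h0) 3
    simp [e] at this
  · intro ht
    have h4 : e 4 ∈ Submodule.span ℝ {e 3} := ht ▸ Submodule.mem_top
    obtain ⟨c, hc⟩ := Submodule.mem_span_singleton.mp h4
    have := congrFun hc 4
    simp [e] at this
  · intro X hX w hw
    obtain ⟨c, rfl⟩ := Submodule.mem_span_singleton.mp hw
    simp [Matrix.mulVec_smul, h X hX]
  · intro w hw hperp
    obtain ⟨c, rfl⟩ := Submodule.mem_span_singleton.mp hw
    have := hperp (e 3) (Submodule.mem_span_singleton_self _)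
    have hc : c = 0 := by simpa [ip, e] using this
    simp [hc]

theorem curv_antisymm (hbk : ∀ x y : V7, L x *ᵥ y - L y *ᵥ x = bk x y) (x y : V7) :
    curv L bk x y = -curv L bk y x := by
  have h : bk x y = -bk y x := by rw [← hbk, ← hbk]; abel
  simp only [curv, h, map_neg]
  abel

/-- The first Bianchi identity. -/
theorem curv_bianchi (hbk : ∀ x y : V7, L x *ᵥ y - L y *ᵥ x = bk x y)
    (hjac : ∀ x y z : V7, bk (bk x y) z + bk (bk y z) x + bk (bk z x) y = 0) (x y z : V7) :
    curv L bk x y *ᵥ z + curv L bk y z *ᵥ x + curv L bk z x *ᵥ y = 0 := by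
  have h := hjac x y z
  rw [← hbk (bk x y), ← hbk (bk y z), ← hbk (bk z x)] at h
  have hz : L z *ᵥ bk x y = L z *ᵥ (L x *ᵥ y) - L z *ᵥ (L y *ᵥ x) := by
    rw [← hbk, Matrix.mulVec_sub]
  have hx : L x *ᵥ bk y z = L x *ᵥ (L y *ᵥ z) - L x *ᵥ (L z *ᵥ y) := by
    rw [← hbk, Matrix.mulVec_sub]
  have hy : L y *ᵥ bk z x = L y *ᵥ (L z *ᵥ x) - L y *ᵥ (L x *ᵥ z) := by
    rw [← hbk, Matrix.mulVec_sub]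
  rw [hx, hy, hz] at h
  simp only [curv, Matrix.sub_mulVec, ← Matrix.mulVec_mulVec]
  rw [← neg_eq_zero, ← h]
  abel

/-- The pair symmetry of the curvature tensor. -/
theorem ip_curv_pair_symm (hbk : ∀ x y : V7, L x *ᵥ y - L y *ᵥ x = bk x y)
    (hjac : ∀ x y z : V7, bk (bk x y) z + bk (bk y z) x + bk (bk z x) y = 0)
    (hL : ∀ x, L x ∈ hIII) (x y z w : V7) :
    ip (curv L bk x y *ᵥ z) w = ip (curv L bk z w *ᵥ x) y := by
  have bianchi (x y z w : V7) : ip (curv L bk x y *ᵥ z) w + ip (curv L bk y z *ᵥ x) w +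
      ip (curv L bk z x *ᵥ y) w = 0 := by
    rw [← ip_add_left, ← ip_add_left, curv_bianchi hbk hjac, ip_zero_left]
  have skew (x y z w : V7) : ip (curv L bk x y *ᵥ z) w = -ip (curv L bk x y *ᵥ w) z := by
    obtain ⟨A, v, p, h⟩ := curv_mem_hIII hL x y (bk := bk)
    rw [h, ip_h3_skew]
  have anti (x y z w : V7) : ip (curv L bk x y *ᵥ z) w = -ip (curv L bk y x *ᵥ z) w := by
    rw [curv_antisymm hbk, Matrix.neg_mulVec]
    simp [ip]
    ring
  linarith [bianchi x y z w, bianchi y z w x, bianchi z w x y, bianchi w x y z,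
    skew x y z w, skew y z x w, skew z x y w, skew z w x y, skew y w x z, skew x w y z,
    skew z x w y, skew w y z x, skew w x y z, skew w x z y, skew y z w x,
    anti x y z w, anti z w x y, anti x z y w, anti w y z x, anti w y x z, anti x w y z,
    anti x w z y, anti z x y w, anti z x w y]

theorem decomposable_infHol (hbk : ∀ x y : V7, L x *ᵥ y - L y *ᵥ x = bk x y)
    (hjac : ∀ x y z : V7, bk (bk x y) z + bk (bk y z) x + bk (bk z x) y = 0)
    (hL : ∀ x, L x ∈ hIII) (h04 : curv L bk (e 0) (e 4) = 0)
    (h34 : curv L bk (e 3) (e 4) = 0) : Decomposable (infHol L bk : Set M7) := by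
  refine decomposable_of_mulVec_e3 fun X hX => ?_
  have hR (x y : V7) : curv L bk x y ∈ traceFreeStabilizer := by
    obtain ⟨A, v, p, hR⟩ := curv_mem_hIII hL x y (bk := bk)
    have htr : A.trace = 0 := by
      have := ip_curv_pair_symm hbk hjac hL x y (e 0) (e 4)
      rw [h04, hR, Matrix.zero_mulVec, ip_zero_left] at this
      simpa [ip, e, h3, hmat, Matrix.trace_fin_two] using this
    have hv : v = 0 := by
      have := ip_curv_pair_symm hbk hjac hL x y (e 3) (e 4)
      rw [h34, hR, Matrix.zero_mulVec, ip_zero_left] at this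
      simpa [ip, e, h3, hmat] using this
    exact ⟨A, p, htr, by rw [hR, hv]⟩
  obtain ⟨A, y, -, rfl⟩ := infHol_le_traceFreeStabilizer hL hR hX
  ext i
  fin_cases i <;> simp [h3, hmat, e]

/-- The first Bianchi identity forces `R(e 3, e 4)` to vanish once it is of the form `h(0,k,0)`. -/
theorem curv_e3_e4_eq_zero (hbk : ∀ x y : V7, L x *ᵥ y - L y *ᵥ x = bk x y)
    (hjac : ∀ x y z : V7, bk (bk x y) z + bk (bk y z) x + bk (bk z x) y = 0)
    (hL : ∀ x, L x ∈ hIII) {k : ℝ} (hk : curv L bk (e 3) (e 4) = h3 0 k 0) :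
    curv L bk (e 3) (e 4) = 0 := by
  obtain ⟨A, u, p, h45⟩ := curv_mem_hIII hL (e 4) (e 5) (bk := bk)
  obtain ⟨B, v, q, h56⟩ := curv_mem_hIII hL (e 5) (e 6) (bk := bk)
  obtain ⟨C, w, r, h64⟩ := curv_mem_hIII hL (e 6) (e 4) (bk := bk)
  have hv : v = 0 := by
    have := congrFun (curv_bianchi hbk hjac (e 4) (e 5) (e 6)) 3
    rw [h45, h56, h64] at this
    simpa [h3, hmat, e] using this
  have hk0 : k = 0 := by
    have := ip_curv_pair_symm hbk hjac hL (e 3) (e 4) (e 5) (e 6)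
    rw [hk, h56, hv] at this
    simpa [h3, hmat, e, ip] using this
  rw [hk, hk0, h3_zero]

end

theorem stmt8 (bk : V7 → V7 → V7) (L : V7 →ₗ[ℝ] M7)
    (hbk : ∀ x y : V7, (L x).mulVec y - (L y).mulVec x = bk x y)
    (halt : ∀ x : V7, bk x x = 0)
    (hjac : ∀ x y z : V7, bk (bk x y) z + bk (bk y z) x + bk (bk z x) y = 0)
    (hL : ∀ x, L x ∈ hIII) :
    ((curv L bk (e 0) (e 4) = 0 ∧ curv L bk (e 3) (e 4) = 0) →
      Decomposable (infHol L bk : Set M7)) ∧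
    ((L (e 0) = 0 ∧ ∃ v : ℝ, L (e 3) = h3 0 v 0) →
      Decomposable (infHol L bk : Set M7)) := by
  refine ⟨fun ⟨h04, h34⟩ => decomposable_infHol hbk hjac hL h04 h34, ?_⟩
  rintro ⟨h0, v, h3v⟩
  obtain ⟨A, u, y, h4⟩ := hL (e 4)
  have bk04 : bk (e 0) (e 4) = -A.trace • e 0 := by
    rw [← hbk, h0, h4]
    ext i
    fin_cases i <;> simp [h3, hmat, e, Matrix.trace_fin_two]
  have bk34 : bk (e 3) (e 4) = (Real.sqrt 2 * v) • e 3 - (Real.sqrt 2 * u) • e 0 := by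
    rw [← hbk, h3v, h4]
    ext i
    fin_cases i <;> simp [h3, hmat, e]
  have h04 : curv L bk (e 0) (e 4) = 0 := by simp [curv, bk04, h0]
  have h34 : curv L bk (e 3) (e 4) = h3 0 (-A.trace * v - Real.sqrt 2 * v * v) 0 := by
    have hc := h3_commutator 0 A v u 0 y
    rw [curv, bk34, map_sub, map_smul, map_smul, h0, h4, h3v, hc]
    simp only [smul_zero, sub_zero]
    rw [sub_eq_add_neg, ← neg_smul, h3_smul, h3_add]
    congr 1 <;> simp; ring
  exact decomposable_infHol hbk hjac hL h04 (curv_e3_e4_eq_zero hbk hjac hL h34)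
end
end
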